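/- arXiv:2207.04841 — 10 statements merged into one kernel-verified Lean document; each statement's English description precedes it below -/
import Mathlib

section
/- (Theorem 3, block capacity utilization) Fix integers m ≥ n ≥ 1, λ > 0, Δ > 0, and a strategy p ∈ ℙ. Then the long-run block capacity utilization, defined as the ratio of series U(p) = [∑_{k=0}^∞ ((λΔ)^k/k!) e^{−λΔ} · ∑_{i=1}^m (1 − (1−p_i)^{k+1})] / [∑_{k=0}^∞ ((λΔ)^k/k!) e^{−λΔ} · (k+1) n], equals the closed form U(p) = (m − ∑_{i=1}^m (1 − p_i) e^{−λΔ p_i}) / (n(λΔ + 1)); consequently the throughput TPS(p) = λ n U(p) = λ (m − ∑_{i=1}^m (1 − p_i) e^{−λΔ p_i}) / (λΔ + 1). -/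
theorem Real.hasSum_pow_div_factorial (x : ℝ) :
    HasSum (fun k : ℕ => x ^ k / (Nat.factorial k : ℝ)) (Real.exp x) := by
  rw [Real.exp_eq_exp_ℝ]
  exact NormedSpace.expSeries_div_hasSum_exp x

theorem Real.hasSum_natCast_mul_pow_div_factorial (x : ℝ) :
    HasSum (fun k : ℕ => (k : ℝ) * (x ^ k / (Nat.factorial k : ℝ))) (x * Real.exp x) := by
  rw [← hasSum_nat_add_iff' 1]
  simp only [Finset.sum_range_one, Nat.cast_zero, zero_mul, sub_zero]
  refine ((Real.hasSum_pow_div_factorial x).mul_left x).congr_fun fun k => ?_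
  rw [Nat.factorial_succ]
  have hk : (Nat.factorial k : ℝ) ≠ 0 := by positivity
  have hk' : (k : ℝ) + 1 ≠ 0 := by positivity
  push_cast
  field_simp
  ring

/-- The Poisson average of `1 - (1 - q) ^ (k + 1)`. -/
theorem hasSum_poisson_one_sub_pow_succ (x q : ℝ) :
    HasSum (fun k : ℕ => (x ^ k / (Nat.factorial k : ℝ)) * Real.exp (-x) *
      (1 - (1 - q) ^ (k + 1))) (1 - (1 - q) * Real.exp (-(x * q))) := by
  have h := ((Real.hasSum_pow_div_factorial x).mul_right (Real.exp (-x))).sub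
    ((Real.hasSum_pow_div_factorial (x * (1 - q))).mul_right ((1 - q) * Real.exp (-x)))
  have e₁ : Real.exp x * Real.exp (-x) = 1 := by rw [← Real.exp_add]; simp
  have e₂ : Real.exp (x * (1 - q)) * ((1 - q) * Real.exp (-x)) =
      (1 - q) * Real.exp (-(x * q)) := by
    rw [mul_left_comm, ← Real.exp_add]
    ring_nf
  rw [e₁, e₂] at h
  refine h.congr_fun fun k => ?_
  rw [mul_pow]
  ring

/-- The Poisson average of `(k + 1) * c`. -/
theorem hasSum_poisson_succ_mul (x c : ℝ) :
    HasSum (fun k : ℕ => (x ^ k / (Nat.factorial k : ℝ)) * Real.exp (-x) *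
      (((k : ℝ) + 1) * c)) (c * (x + 1)) := by
  have h := ((Real.hasSum_natCast_mul_pow_div_factorial x).add
    (Real.hasSum_pow_div_factorial x)).mul_right (Real.exp (-x) * c)
  have e₁ : Real.exp x * Real.exp (-x) = 1 := by rw [← Real.exp_add]; simp
  have e₂ : (x * Real.exp x + Real.exp x) * (Real.exp (-x) * c) = c * (x + 1) := by
    linear_combination c * (x + 1) * e₁
  rw [e₂] at h
  refine h.congr_fun fun k => ?_
  ring

/-- Theorem 3: the long-run block capacity utilization, defined as a ratio of
Poisson-averaged series, equals the closed form
`(m − ∑_i (1−p_i) e^{−λΔ p_i})/(n(λΔ+1))`; consequently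
`TPS(p) = λ n U(p) = λ (m − ∑_i (1−p_i) e^{−λΔ p_i})/(λΔ+1)`. -/
theorem block_capacity_utilization (m n : ℕ) (hn : 1 ≤ n) (hmn : n ≤ m)
    (lam Δ : ℝ) (hlam : 0 < lam) (hΔ : 0 < Δ) (p : ℕ → ℝ)
    (hp0 : ∀ i ∈ Finset.Icc 1 m, 0 ≤ p i) (hp1 : ∀ i ∈ Finset.Icc 1 m, p i ≤ 1)
    (hpsum : ∑ i ∈ Finset.Icc 1 m, p i = (n : ℝ)) :
    (∑' k : ℕ, ((lam * Δ) ^ k / (Nat.factorial k : ℝ)) * Real.exp (-(lam * Δ)) *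
        ∑ i ∈ Finset.Icc 1 m, (1 - (1 - p i) ^ (k + 1))) /
      (∑' k : ℕ, ((lam * Δ) ^ k / (Nat.factorial k : ℝ)) * Real.exp (-(lam * Δ)) *
        (((k : ℝ) + 1) * (n : ℝ)))
      = ((m : ℝ) - ∑ i ∈ Finset.Icc 1 m, (1 - p i) * Real.exp (-(lam * Δ * p i))) /
          ((n : ℝ) * (lam * Δ + 1))
    ∧ lam * (n : ℝ) *
        (((m : ℝ) - ∑ i ∈ Finset.Icc 1 m, (1 - p i) * Real.exp (-(lam * Δ * p i))) /
          ((n : ℝ) * (lam * Δ + 1)))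
      = lam * ((m : ℝ) - ∑ i ∈ Finset.Icc 1 m, (1 - p i) * Real.exp (-(lam * Δ * p i))) /
          (lam * Δ + 1) := by
  have hnum : HasSum (fun k : ℕ => ((lam * Δ) ^ k / (Nat.factorial k : ℝ)) *
      Real.exp (-(lam * Δ)) * ∑ i ∈ Finset.Icc 1 m, (1 - (1 - p i) ^ (k + 1)))
      ((m : ℝ) - ∑ i ∈ Finset.Icc 1 m, (1 - p i) * Real.exp (-(lam * Δ * p i))) := by
    have h := hasSum_sum fun i (_ : i ∈ Finset.Icc 1 m) =>
      hasSum_poisson_one_sub_pow_succ (lam * Δ) (p i)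
    simpa [← Finset.mul_sum, Finset.sum_sub_distrib] using h
  have hn0 : (n : ℝ) ≠ 0 := by positivity
  refine ⟨by rw [hnum.tsum_eq, (hasSum_poisson_succ_mul (lam * Δ) n).tsum_eq], ?_⟩
  rw [← mul_div_assoc, mul_comm lam (n : ℝ), mul_assoc, mul_div_mul_left _ _ hn0]
end

section
/- For every strategy p ∈ ℙ, the block capacity utilization is at most one; that is, m − ∑_{i=1}^m (1 − p_i) e^{−λΔ p_i} ≤ n(λΔ + 1), and consequently TPS(p) = λ (m − ∑_{i=1}^m (1 − p_i) e^{−λΔ p_i}) / (λΔ + 1) ≤ λn. -/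
/-- A first-order bound on one summand of the utilization. -/
theorem one_sub_mul_exp_neg_le {a x : ℝ} (ha : 0 ≤ a) (hx : x ≤ 1) :
    1 - (1 - x) * Real.exp (-(a * x)) ≤ x * (a + 1) := by
  have h := mul_le_mul_of_nonneg_left (Real.add_one_le_exp (-(a * x))) (sub_nonneg.2 hx)
  nlinarith [mul_nonneg ha (sq_nonneg x)]

/-- The block capacity utilization is at most one:
`m − ∑_i (1−p_i) e^{−λΔ p_i} ≤ n(λΔ+1)`, and consequently `TPS(p) ≤ λn`. -/
theorem utilization_le_one (m n : ℕ) (hn : 1 ≤ n) (hmn : n ≤ m)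
    (lam Δ : ℝ) (hlam : 0 < lam) (hΔ : 0 < Δ) (p : ℕ → ℝ)
    (hp0 : ∀ i ∈ Finset.Icc 1 m, 0 ≤ p i) (hp1 : ∀ i ∈ Finset.Icc 1 m, p i ≤ 1)
    (hpsum : ∑ i ∈ Finset.Icc 1 m, p i = (n : ℝ)) :
    (m : ℝ) - ∑ i ∈ Finset.Icc 1 m, (1 - p i) * Real.exp (-(lam * Δ * p i))
      ≤ (n : ℝ) * (lam * Δ + 1)
    ∧ lam * ((m : ℝ) - ∑ i ∈ Finset.Icc 1 m, (1 - p i) * Real.exp (-(lam * Δ * p i))) /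
        (lam * Δ + 1) ≤ lam * (n : ℝ) := by
  have ha : 0 < lam * Δ := mul_pos hlam hΔ
  have key : (m : ℝ) - ∑ i ∈ Finset.Icc 1 m, (1 - p i) * Real.exp (-(lam * Δ * p i))
      ≤ (n : ℝ) * (lam * Δ + 1) := by
    calc (m : ℝ) - ∑ i ∈ Finset.Icc 1 m, (1 - p i) * Real.exp (-(lam * Δ * p i))
        = ∑ i ∈ Finset.Icc 1 m, (1 - (1 - p i) * Real.exp (-(lam * Δ * p i))) := by
          simp [Finset.sum_sub_distrib]
      _ ≤ ∑ i ∈ Finset.Icc 1 m, p i * (lam * Δ + 1) :=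
          Finset.sum_le_sum fun i hi => one_sub_mul_exp_neg_le ha.le (hp1 i hi)
      _ = (n : ℝ) * (lam * Δ + 1) := by rw [← Finset.sum_mul, hpsum]
  refine ⟨key, ?_⟩
  rw [div_le_iff₀ (by positivity), mul_assoc]
  exact mul_le_mul_of_nonneg_left key hlam.le
end

section
/- (Theorem 2, random strategy is a ξ-approximate Nash equilibrium) Let ξ = n · ((1 − e^{−λΔ n/m}) / (λΔ n/m)) · ((1/n) ∑_{i=1}^n f_i − (1/m) ∑_{i=1}^m f_i). Then for every strategy p ∈ ℙ, R(p | p^rand) ≤ R(p^rand) + ξ, where p^rand is the random strategy; moreover equality holds for p = p^top, so ξ = max_{p ∈ ℙ} R(p | p^rand) − R(p^rand). -/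
/-- Expected reward share `r(q|δ) = (1 − e^{−λδq})/(λδq)` for `q ∈ (0,1]`, with `r(0|δ) = 1`. -/
noncomputable def rshare (lam del q : ℝ) : ℝ :=
  if q = 0 then 1 else (1 - Real.exp (-(lam * del * q))) / (lam * del * q)

/-- Revenue `R(p|p') = ∑_{i=1}^m p_i f_i r(p'_i|δ)` of a miner playing `p` when all
others play `p'`, under delay `del`. -/
noncomputable def Rev (lam del : ℝ) (m : ℕ) (f p p' : ℕ → ℝ) : ℝ :=
  ∑ i ∈ Finset.Icc 1 m, p i * f i * rshare lam del (p' i)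

theorem Rev_const (lam del : ℝ) (m : ℕ) (f p : ℕ → ℝ) (q : ℝ) :
    Rev lam del m f p (fun _ => q) = (∑ i ∈ Finset.Icc 1 m, p i * f i) * rshare lam del q := by
  simp only [Rev, Finset.sum_mul]

theorem sum_Icc_indicator_mul {m n : ℕ} (hmn : n ≤ m) (g : ℕ → ℝ) :
    ∑ i ∈ Finset.Icc 1 m, (if i ≤ n then (1 : ℝ) else 0) * g i = ∑ i ∈ Finset.Icc 1 n, g i := by
  simp only [ite_mul, one_mul, zero_mul, ← Finset.sum_filter]
  congr 1
  ext i
  simp only [Finset.mem_filter, Finset.mem_Icc]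
  omega

/-- A weighted sum with weights in `[0, 1]` of total weight `n` is at most the sum of the first
`n` terms of an antitone sequence. -/
theorem sum_mul_le_sum_top {m n : ℕ} (hn : 1 ≤ n) (hmn : n ≤ m) (f p : ℕ → ℝ)
    (hf : ∀ i j : ℕ, 1 ≤ i → i ≤ j → j ≤ m → f j ≤ f i)
    (hp0 : ∀ i ∈ Finset.Icc 1 m, 0 ≤ p i) (hp1 : ∀ i ∈ Finset.Icc 1 m, p i ≤ 1)
    (hp : ∑ i ∈ Finset.Icc 1 m, p i = (n : ℝ)) :
    ∑ i ∈ Finset.Icc 1 m, p i * f i ≤ ∑ i ∈ Finset.Icc 1 n, f i := by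
  have hterm : ∑ i ∈ Finset.Icc 1 m, p i * (f i - f n) ≤
      ∑ i ∈ Finset.Icc 1 m, (if i ≤ n then (1 : ℝ) else 0) * (f i - f n) := by
    refine Finset.sum_le_sum fun i hi => ?_
    have him := Finset.mem_Icc.1 hi
    split_ifs with h
    · exact mul_le_mul_of_nonneg_right (hp1 i hi) (sub_nonneg.2 (hf i n him.1 h hmn))
    · rw [zero_mul]
      exact mul_nonpos_of_nonneg_of_nonpos (hp0 i hi)
        (sub_nonpos.2 (hf n i hn (by omega) him.2))
  rw [sum_Icc_indicator_mul hmn] at hterm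
  simp only [mul_sub, Finset.sum_sub_distrib, ← Finset.sum_mul, hp] at hterm
  simpa using hterm

/-- Theorem 2: the random strategy `p^rand` (with `p_i = n/m`) is a ξ-approximate Nash
equilibrium with `ξ = n ((1 − e^{−λΔn/m})/(λΔn/m)) ((1/n)∑_{i≤n} f_i − (1/m)∑_{i≤m} f_i)`;
moreover the maximal deviation gain is exactly `ξ`, attained by the top-`n` strategy. -/
theorem random_strategy_approx_NE (m n : ℕ) (hn : 1 ≤ n) (hmn : n ≤ m)
    (lam Δ : ℝ) (hlam : 0 < lam) (hΔ : 0 < Δ) (f : ℕ → ℝ)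
    (hf0 : ∀ i ∈ Finset.Icc 1 m, 0 ≤ f i)
    (hf : ∀ i j : ℕ, 1 ≤ i → i ≤ j → j ≤ m → f j ≤ f i) :
    let prand : ℕ → ℝ := fun _ => (n : ℝ) / (m : ℝ)
    let ptop : ℕ → ℝ := fun i => if i ≤ n then 1 else 0
    let ξ : ℝ := (n : ℝ) *
      ((1 - Real.exp (-(lam * Δ * ((n : ℝ) / (m : ℝ))))) / (lam * Δ * ((n : ℝ) / (m : ℝ)))) *
      ((1 / (n : ℝ)) * ∑ i ∈ Finset.Icc 1 n, f i - (1 / (m : ℝ)) * ∑ i ∈ Finset.Icc 1 m, f i)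
    (∀ p : ℕ → ℝ, (∀ i ∈ Finset.Icc 1 m, 0 ≤ p i) → (∀ i ∈ Finset.Icc 1 m, p i ≤ 1) →
        ∑ i ∈ Finset.Icc 1 m, p i = (n : ℝ) →
        Rev lam Δ m f p prand ≤ Rev lam Δ m f prand prand + ξ)
    ∧ Rev lam Δ m f ptop prand = Rev lam Δ m f prand prand + ξ := by
  intro prand ptop ξ
  have hn0 : (0 : ℝ) < n := by exact_mod_cast hn
  have hm0 : (0 : ℝ) < m := by exact_mod_cast hn.trans hmn
  have hq : 0 < (n : ℝ) / m := div_pos hn0 hm0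
  have hr : rshare lam Δ ((n : ℝ) / m) =
      (1 - Real.exp (-(lam * Δ * ((n : ℝ) / m)))) / (lam * Δ * ((n : ℝ) / m)) :=
    if_neg hq.ne'
  have hr0 : 0 ≤ rshare lam Δ ((n : ℝ) / m) := by
    have hx : 0 < lam * Δ * ((n : ℝ) / m) := by positivity
    rw [hr]
    exact div_nonneg (sub_nonneg.2 (Real.exp_le_one_iff.2 (by linarith))) hx.le
  have hξ : Rev lam Δ m f prand prand + ξ =
      (∑ i ∈ Finset.Icc 1 n, f i) * rshare lam Δ ((n : ℝ) / m) := by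
    simp only [prand, ξ, Rev_const, ← hr, ← Finset.mul_sum]
    field_simp
    ring
  rw [hξ]
  refine ⟨fun p hp0 hp1 hp => ?_, ?_⟩
  · simp only [prand, Rev_const]
    exact mul_le_mul_of_nonneg_right (sum_mul_le_sum_top hn hmn f p hf hp0 hp1 hp) hr0
  · simp only [prand, ptop, Rev_const, sum_Icc_indicator_mul hmn]
end

section
/- (Theorem 5, top-n strategy is an η-approximate Nash equilibrium) Let η = n (1 − (1 − e^{−λτ})/(λτ)) f_n. Then for every strategy p ∈ ℙ, R(p | p^top) ≤ R(p^top) + η, where the revenues are evaluated with network propagation delay τ (the signal propagation delay in TIPS); in particular η ≥ 0. -/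
/-- The share `(1 - e⁻ˣ) / x` lies in `[0, 1]` for positive `x`. -/
lemma one_sub_exp_neg_div_mem_Icc {x : ℝ} (hx : 0 < x) :
    (1 - Real.exp (-x)) / x ∈ Set.Icc (0 : ℝ) 1 := by
  constructor
  · have h : Real.exp (-x) ≤ 1 := Real.exp_le_one_iff.mpr (by linarith)
    exact div_nonneg (by linarith) hx.le
  · rw [div_le_one hx]
    linarith [Real.add_one_le_exp (-x)]

lemma sum_Icc_ite_le_eq {m n : ℕ} (hmn : n ≤ m) :
    ∑ i ∈ Finset.Icc 1 m, (if i ≤ n then (1 : ℝ) else 0) = n := by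
  have h : (Finset.Icc 1 m).filter (· ≤ n) = Finset.Icc 1 n := by
    ext i
    simp only [Finset.mem_filter, Finset.mem_Icc]
    omega
  rw [← Finset.sum_filter, h]
  simp

/-- Theorem 5: the top-`n` strategy is an η-approximate Nash equilibrium with
`η = n (1 − (1 − e^{−λτ})/(λτ)) f_n`, under the TIPS signal delay `τ`; in particular `η ≥ 0`. -/
theorem top_n_approx_NE (m n : ℕ) (hn : 1 ≤ n) (hmn : n ≤ m)
    (lam τ : ℝ) (hlam : 0 < lam) (hτ : 0 < τ) (f : ℕ → ℝ)
    (hf0 : ∀ i ∈ Finset.Icc 1 m, 0 ≤ f i)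
    (hf : ∀ i j : ℕ, 1 ≤ i → i ≤ j → j ≤ m → f j ≤ f i) :
    let ptop : ℕ → ℝ := fun i => if i ≤ n then 1 else 0
    let η : ℝ := (n : ℝ) * (1 - (1 - Real.exp (-(lam * τ))) / (lam * τ)) * f n
    (∀ p : ℕ → ℝ, (∀ i ∈ Finset.Icc 1 m, 0 ≤ p i) → (∀ i ∈ Finset.Icc 1 m, p i ≤ 1) →
        ∑ i ∈ Finset.Icc 1 m, p i = (n : ℝ) →
        Rev lam τ m f p ptop ≤ Rev lam τ m f ptop ptop + η)
    ∧ 0 ≤ η := by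
  intro ptop η
  obtain ⟨hr0, hr1⟩ := one_sub_exp_neg_div_mem_Icc (mul_pos hlam hτ)
  set r : ℝ := (1 - Real.exp (-(lam * τ))) / (lam * τ) with hr
  have hfn : 0 ≤ f n := hf0 n (Finset.mem_Icc.mpr ⟨hn, hmn⟩)
  have hη : η = n * (1 - r) * f n := rfl
  have hsub : 0 ≤ (1 - r) * f n := mul_nonneg (by linarith) hfn
  refine ⟨fun p hp0 hp1 hsum => ?_, ?_⟩
  · have hpt : ∀ i ∈ Finset.Icc 1 m, p i * f i * rshare lam τ (ptop i) ≤
        ptop i * f i * rshare lam τ (ptop i) + r * f n * (p i - ptop i)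
          + (1 - r) * f n * p i := by
      intro i hi
      obtain ⟨h1i, him⟩ := Finset.mem_Icc.mp hi
      have hpi := hp0 i hi
      by_cases hin : i ≤ n
      · have ht : ptop i = 1 := if_pos hin
        have hs : rshare lam τ 1 = r := by simp [rshare, hr]
        rw [ht, hs]
        have h := mul_nonneg hr0 (mul_nonneg (sub_nonneg.mpr (hp1 i hi))
          (sub_nonneg.mpr (hf i n h1i hin hmn)))
        nlinarith [mul_nonneg hsub hpi]
      · have ht : ptop i = 0 := if_neg hin
        have hs : rshare lam τ 0 = 1 := if_pos rfl
        rw [ht, hs]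
        have h := mul_nonneg hpi (sub_nonneg.mpr (hf n i hn (by omega) him))
        linarith
    have htop : ∑ i ∈ Finset.Icc 1 m, ptop i = (n : ℝ) := sum_Icc_ite_le_eq hmn
    have h := Finset.sum_le_sum hpt
    rw [Finset.sum_add_distrib, Finset.sum_add_distrib, ← Finset.mul_sum, ← Finset.mul_sum,
      Finset.sum_sub_distrib, hsum, htop] at h
    rw [hη]
    unfold Rev
    linarith
  · rw [hη, mul_assoc]
    exact mul_nonneg n.cast_nonneg hsub
end

section
/- (Refined deviation bound for the top-n strategy) Suppose m ≥ n + 1. Then for every strategy p ∈ ℙ, R(p | p^top) − R(p^top) ≤ max{ n f_{n+1} − n ((1 − e^{−λτ})/(λτ)) f_n , 0 }, where the revenues are evaluated with network propagation delay τ. -/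
/-- Refined deviation bound for the top-`n` strategy: for `m ≥ n+1`,
`R(p|p^top) − R(p^top) ≤ max{ n f_{n+1} − n ((1−e^{−λτ})/(λτ)) f_n , 0 }`. -/
theorem top_n_deviation_bound (m n : ℕ) (hn : 1 ≤ n) (hmn : n + 1 ≤ m)
    (lam τ : ℝ) (hlam : 0 < lam) (hτ : 0 < τ) (f : ℕ → ℝ)
    (hf0 : ∀ i ∈ Finset.Icc 1 m, 0 ≤ f i)
    (hf : ∀ i j : ℕ, 1 ≤ i → i ≤ j → j ≤ m → f j ≤ f i) :
    let ptop : ℕ → ℝ := fun i => if i ≤ n then 1 else 0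
    ∀ p : ℕ → ℝ, (∀ i ∈ Finset.Icc 1 m, 0 ≤ p i) → (∀ i ∈ Finset.Icc 1 m, p i ≤ 1) →
      ∑ i ∈ Finset.Icc 1 m, p i = (n : ℝ) →
      Rev lam τ m f p ptop - Rev lam τ m f ptop ptop ≤
        max ((n : ℝ) * f (n + 1) - (n : ℝ) * ((1 - Real.exp (-(lam * τ))) / (lam * τ)) * f n) 0 := by
  intro ptop p hp0 hp1 hpsum
  set c : ℝ := (1 - Real.exp (-(lam * τ))) / (lam * τ) with hc
  have hpos : 0 < lam * τ := mul_pos hlam hτ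
  have hc0 : 0 ≤ c := by
    apply div_nonneg _ hpos.le
    have : Real.exp (-(lam * τ)) ≤ 1 := Real.exp_le_one_iff.mpr (by linarith)
    linarith
  have hr1 : rshare lam τ 1 = c := by simp [rshare, hc]
  have hr0 : rshare lam τ 0 = 1 := by simp [rshare]
  have htop : ∑ i ∈ Finset.Icc 1 m, ptop i = n := by
    have hfilter : (Finset.Icc 1 m).filter (fun i => i ≤ n) = Finset.Icc 1 n := by
      ext i
      simp only [Finset.mem_filter, Finset.mem_Icc]
      omega
    simp only [ptop, Finset.sum_boole, hfilter, Nat.card_Icc, Nat.add_sub_cancel]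
  set S : ℝ := ∑ i ∈ Finset.Icc 1 m, (1 - ptop i) * p i with hS
  have hS0 : 0 ≤ S := by
    refine Finset.sum_nonneg fun i hi => mul_nonneg ?_ (hp0 i hi)
    by_cases h : i ≤ n <;> simp [ptop, h]
  have hSn : S ≤ n := by
    rw [← hpsum]
    refine Finset.sum_le_sum fun i hi => ?_
    have := hp0 i hi
    by_cases h : i ≤ n <;> simp [ptop, h, this]
  have hdiff : Rev lam τ m f p ptop - Rev lam τ m f ptop ptop ≤ S * (f (n + 1) - c * f n) := by
    calc Rev lam τ m f p ptop - Rev lam τ m f ptop ptop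
        ≤ ∑ i ∈ Finset.Icc 1 m,
            ((p i - ptop i) * (c * f n) + (1 - ptop i) * p i * (f (n + 1) - c * f n)) := by
          rw [Rev, Rev, ← Finset.sum_sub_distrib]
          refine Finset.sum_le_sum fun i hi => ?_
          obtain ⟨hi1, him⟩ := Finset.mem_Icc.mp hi
          by_cases h : i ≤ n
          · have hfi : c * f n ≤ c * f i :=
              mul_le_mul_of_nonneg_left (hf i n hi1 h (by omega)) hc0
            have := mul_le_mul_of_nonneg_left hfi (sub_nonneg.mpr (hp1 i hi))
            simp only [ptop, h, if_true, hr1]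
            linarith
          · have := mul_le_mul_of_nonneg_left (hf (n + 1) i (by omega) (by omega) him) (hp0 i hi)
            simp only [ptop, h, if_false, hr0]
            linarith
      _ = S * (f (n + 1) - c * f n) := by
          rw [Finset.sum_add_distrib, ← Finset.sum_mul, ← Finset.sum_mul,
            Finset.sum_sub_distrib, hpsum, htop, sub_self, zero_mul, zero_add]
  refine hdiff.trans ?_
  rcases le_total 0 (f (n + 1) - c * f n) with hD | hD
  · refine le_max_of_le_left ?_
    have := mul_le_mul_of_nonneg_right hSn hD
    linarith
  · exact le_max_of_le_right (mul_nonpos_of_nonneg_of_nonpos hS0 hD)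
end

section
/- (Theorem 6, top-n strategy is a Nash equilibrium for small delay) Suppose m ≥ n + 1, f_n > 0, and the signal propagation delay τ satisfies (1 − e^{−λτ})/(λτ) ≥ f_{n+1}/f_n. Then the top-n strategy is a Nash equilibrium: for every strategy p ∈ ℙ, R(p | p^top) ≤ R(p^top), where revenues are evaluated with delay τ. -/
/-- A capped allocation is optimal when it is full wherever the marginal value is at least a
threshold `t` and empty wherever it is at most `t`. -/
theorem sum_mul_le_sum_of_threshold {ι : Type*} (s : Finset ι) (p q c : ι → ℝ) (t : ℝ)
    (hp0 : ∀ i ∈ s, 0 ≤ p i) (hp1 : ∀ i ∈ s, p i ≤ 1)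
    (hsum : ∑ i ∈ s, p i = ∑ i ∈ s, q i)
    (hq : ∀ i ∈ s, (q i = 1 ∧ t ≤ c i) ∨ (q i = 0 ∧ c i ≤ t)) :
    ∑ i ∈ s, p i * c i ≤ ∑ i ∈ s, q i * c i := by
  have h : ∑ i ∈ s, (p i * c i - p i * t) ≤ ∑ i ∈ s, (q i * c i - q i * t) := by
    refine Finset.sum_le_sum fun i hi => ?_
    rcases hq i hi with ⟨h1, h2⟩ | ⟨h1, h2⟩
    · rw [h1]
      nlinarith [mul_nonneg (sub_nonneg.2 (hp1 i hi)) (sub_nonneg.2 h2)]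
    · rw [h1]
      nlinarith [mul_nonneg (hp0 i hi) (sub_nonneg.2 h2)]
  simp only [Finset.sum_sub_distrib, ← Finset.sum_mul, hsum] at h
  linarith

/-- Theorem 6: if `f_n > 0` and the signal delay `τ` satisfies
`(1 − e^{−λτ})/(λτ) ≥ f_{n+1}/f_n`, then the top-`n` strategy is a Nash equilibrium:
every deviation `p ∈ ℙ` satisfies `R(p|p^top) ≤ R(p^top)`. -/
theorem top_n_NE (m n : ℕ) (hn : 1 ≤ n) (hmn : n + 1 ≤ m)
    (lam τ : ℝ) (hlam : 0 < lam) (hτ : 0 < τ) (f : ℕ → ℝ)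
    (hf0 : ∀ i ∈ Finset.Icc 1 m, 0 ≤ f i)
    (hf : ∀ i j : ℕ, 1 ≤ i → i ≤ j → j ≤ m → f j ≤ f i)
    (hfn : 0 < f n)
    (hr : (1 - Real.exp (-(lam * τ))) / (lam * τ) ≥ f (n + 1) / f n) :
    let ptop : ℕ → ℝ := fun i => if i ≤ n then 1 else 0
    ∀ p : ℕ → ℝ, (∀ i ∈ Finset.Icc 1 m, 0 ≤ p i) → (∀ i ∈ Finset.Icc 1 m, p i ≤ 1) →
      ∑ i ∈ Finset.Icc 1 m, p i = (n : ℝ) →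
      Rev lam τ m f p ptop ≤ Rev lam τ m f ptop ptop := by
  intro ptop p hp0 hp1 hsum
  set r := (1 - Real.exp (-(lam * τ))) / (lam * τ) with hrdef
  have hr0 : 0 ≤ r :=
    (div_nonneg (hf0 (n + 1) (Finset.mem_Icc.2 ⟨by omega, hmn⟩)) hfn.le).trans hr
  have hsucc : f (n + 1) ≤ f n * r := by
    have := (div_le_iff₀ hfn).1 hr
    linarith
  have hsum_top : ∑ i ∈ Finset.Icc 1 m, ptop i = (n : ℝ) := by
    have hfilter : {i ∈ Finset.Icc 1 m | i ≤ n} = Finset.Icc 1 n := by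
      ext i
      simp only [Finset.mem_filter, Finset.mem_Icc]
      omega
    simp only [ptop, Finset.sum_ite, Finset.sum_const_zero, add_zero, hfilter]
    simp
  simp only [Rev, mul_assoc]
  refine sum_mul_le_sum_of_threshold _ p ptop _ (f n * r) hp0 hp1 (hsum.trans hsum_top.symm) ?_
  intro i hi
  obtain ⟨hi1, him⟩ := Finset.mem_Icc.1 hi
  by_cases hin : i ≤ n
  · refine Or.inl ⟨by simp [ptop, hin], ?_⟩
    have hshare : rshare lam τ (ptop i) = r := by simp [rshare, ptop, hin, hrdef]
    rw [hshare]
    exact mul_le_mul_of_nonneg_right (hf i n hi1 hin (by omega)) hr0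
  · refine Or.inr ⟨by simp [ptop, hin], ?_⟩
    have hshare : rshare lam τ (ptop i) = 1 := by simp [rshare, ptop, hin]
    rw [hshare, mul_one]
    exact (hf (n + 1) i (by omega) (by omega) him).trans hsucc
end

section
/- (Pure-deviation inequality in Theorem 6) Suppose m ≥ n + 1, f_n > 0, and r := (1 − e^{−λτ})/(λτ) satisfies r ≥ f_{n+1}/f_n. Let A = {1, …, n}. Then for every subset B ⊆ {1, …, m} with |B| = n, ∑_{i ∈ B∖A} f_i + r ∑_{i ∈ B∩A} f_i ≤ r ∑_{i ∈ A} f_i. -/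
/-- Pure-deviation inequality in Theorem 6: if `r = (1 − e^{−λτ})/(λτ) ≥ f_{n+1}/f_n`
and `A = {1,…,n}`, then for every `B ⊆ {1,…,m}` with `|B| = n`,
`∑_{i∈B∖A} f_i + r ∑_{i∈B∩A} f_i ≤ r ∑_{i∈A} f_i`. -/
theorem pure_deviation_inequality (m n : ℕ) (hn : 1 ≤ n) (hmn : n + 1 ≤ m)
    (lam τ : ℝ) (hlam : 0 < lam) (hτ : 0 < τ) (f : ℕ → ℝ)
    (hf0 : ∀ i ∈ Finset.Icc 1 m, 0 ≤ f i)
    (hf : ∀ i j : ℕ, 1 ≤ i → i ≤ j → j ≤ m → f j ≤ f i)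
    (hfn : 0 < f n)
    (hr : (1 - Real.exp (-(lam * τ))) / (lam * τ) ≥ f (n + 1) / f n) :
    let r : ℝ := (1 - Real.exp (-(lam * τ))) / (lam * τ)
    let A : Finset ℕ := Finset.Icc 1 n
    ∀ B : Finset ℕ, B ⊆ Finset.Icc 1 m → B.card = n →
      ∑ i ∈ B \ A, f i + r * ∑ i ∈ B ∩ A, f i ≤ r * ∑ i ∈ A, f i := by
  intro r A B hB hcard
  have hr0 : 0 ≤ r :=
    (div_nonneg (hf0 _ (Finset.mem_Icc.2 ⟨by omega, hmn⟩)) hfn.le).trans hr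
  have hstep : f (n + 1) ≤ r * f n := (div_le_iff₀ hfn).1 hr
  have hcardA : A.card = B.card := by simp [A, hcard]
  have hsdiff : (B \ A).card = (A \ B).card := Finset.card_sdiff_comm hcardA.symm
  have hout : ∑ i ∈ B \ A, f i ≤ (B \ A).card • (r * f n) := by
    refine Finset.sum_le_card_nsmul _ _ _ fun i hi => ?_
    obtain ⟨hiB, hiA⟩ := Finset.mem_sdiff.1 hi
    have him := Finset.mem_Icc.1 (hB hiB)
    have hni : n + 1 ≤ i := by
      by_contra! h
      exact hiA (Finset.mem_Icc.2 ⟨him.1, by omega⟩)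
    exact (hf (n + 1) i (by omega) hni him.2).trans hstep
  have hin : (A \ B).card • (r * f n) ≤ r * ∑ i ∈ A \ B, f i := by
    rw [Finset.mul_sum]
    refine Finset.card_nsmul_le_sum _ _ _ fun i hi => ?_
    have hiA := Finset.mem_Icc.1 (Finset.mem_sdiff.1 hi).1
    exact mul_le_mul_of_nonneg_left (hf i n hiA.1 hiA.2 (by omega)) hr0
  rw [hsdiff] at hout
  rw [← Finset.sum_inter_add_sum_sdiff A B f, Finset.inter_comm A B, mul_add]
  linarith
end

section
/- (Equilibrium revenue lower bound) Suppose p* ∈ ℙ is a symmetric Nash equilibrium of the transaction inclusion game with delay τ, i.e., R(p* | p*) ≥ R(p | p*) for all p ∈ ℙ. Then R(p*) ≥ ((1 − e^{−λτ})/(λτ)) ∑_{i=1}^{n} f_i. -/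
/-- On `[0, 1]` the reward share is at least its value at full inclusion probability. -/
theorem one_sub_exp_div_le_rshare {lam del q : ℝ} (hlam : 0 < lam) (hdel : 0 < del)
    (hq0 : 0 ≤ q) (hq1 : q ≤ 1) :
    (1 - Real.exp (-(lam * del))) / (lam * del) ≤ rshare lam del q := by
  have hc : 0 < lam * del := mul_pos hlam hdel
  unfold rshare
  split_ifs with h
  · rw [div_le_one hc]
    linarith [Real.add_one_le_exp (-(lam * del))]
  · have hq : 0 < q := lt_of_le_of_ne hq0 (Ne.symm h)
    have hconv := convexOn_exp.2 (Set.mem_univ 0) (Set.mem_univ (-(lam * del)))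
      (sub_nonneg.2 hq1) hq0 (sub_add_cancel 1 q)
    simp only [smul_eq_mul, mul_zero, zero_add, Real.exp_zero, mul_one] at hconv
    rw [show q * -(lam * del) = -(lam * del * q) by ring] at hconv
    rw [div_le_div_iff₀ hc (mul_pos hc hq)]
    nlinarith

/-- Equilibrium revenue lower bound: if `p*` is a symmetric Nash equilibrium of the
transaction inclusion game with delay `τ`, then
`R(p*) ≥ ((1 − e^{−λτ})/(λτ)) ∑_{i=1}^n f_i`. -/
theorem equilibrium_revenue_lower_bound (m n : ℕ) (hn : 1 ≤ n) (hmn : n ≤ m)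
    (lam τ : ℝ) (hlam : 0 < lam) (hτ : 0 < τ) (f : ℕ → ℝ)
    (hf0 : ∀ i ∈ Finset.Icc 1 m, 0 ≤ f i)
    (hf : ∀ i j : ℕ, 1 ≤ i → i ≤ j → j ≤ m → f j ≤ f i)
    (pstar : ℕ → ℝ)
    (hp0 : ∀ i ∈ Finset.Icc 1 m, 0 ≤ pstar i) (hp1 : ∀ i ∈ Finset.Icc 1 m, pstar i ≤ 1)
    (hpsum : ∑ i ∈ Finset.Icc 1 m, pstar i = (n : ℝ))
    (hNE : ∀ p : ℕ → ℝ, (∀ i ∈ Finset.Icc 1 m, 0 ≤ p i) → (∀ i ∈ Finset.Icc 1 m, p i ≤ 1) →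
      ∑ i ∈ Finset.Icc 1 m, p i = (n : ℝ) →
      Rev lam τ m f p pstar ≤ Rev lam τ m f pstar pstar) :
    Rev lam τ m f pstar pstar ≥
      ((1 - Real.exp (-(lam * τ))) / (lam * τ)) * ∑ i ∈ Finset.Icc 1 n, f i := by
  have hfilter : (Finset.Icc 1 m).filter (fun i => i ≤ n) = Finset.Icc 1 n := by
    ext i
    simp only [Finset.mem_filter, Finset.mem_Icc]
    lia
  have hdev := hNE (fun i => if i ≤ n then 1 else 0)
    (fun i _ => by split_ifs <;> norm_num)
    (fun i _ => by split_ifs <;> norm_num)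
    (by rw [← Finset.sum_filter, hfilter]; simp)
  refine le_trans ?_ hdev
  simp only [Rev, ite_mul, one_mul, zero_mul]
  rw [← Finset.sum_filter, hfilter, Finset.mul_sum]
  refine Finset.sum_le_sum fun i hi => ?_
  have him : i ∈ Finset.Icc 1 m := Finset.Icc_subset_Icc_right hmn hi
  rw [mul_comm]
  exact mul_le_mul_of_nonneg_left
    (one_sub_exp_div_le_rshare hlam hτ (hp0 i him) (hp1 i him)) (hf0 i him)
end

section
/- (Throughput efficiency of TIPS, proven form of Theorem 8) For every strategy p ∈ ℙ and every propagation delay Δ > 0, the throughput of the top-n strategy under the TIPS signal delay τ > 0 satisfies TPS_τ(p^top) ≥ TPS_Δ(p) / (λτ + 1); that is, the efficiency of the top-n strategy under TIPS relative to any strategy under any delay is at least 1/(λτ + 1). -/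
/-- Throughput `TPS_δ(p) = λ (m − ∑_i (1−p_i) e^{−λδ p_i})/(λδ + 1)`. -/
noncomputable def TPS (lam del : ℝ) (m : ℕ) (p : ℕ → ℝ) : ℝ :=
  lam * ((m : ℝ) - ∑ i ∈ Finset.Icc 1 m, (1 - p i) * Real.exp (-(lam * del * p i))) /
    (lam * del + 1)

/-- The throughput of any strategy is at most `λ` times the sum of its entries. -/
theorem TPS_le_mul_sum {lam del : ℝ} {m : ℕ} {p : ℕ → ℝ} (hlam : 0 ≤ lam) (hdel : 0 ≤ del)
    (hp1 : ∀ i ∈ Finset.Icc 1 m, p i ≤ 1) :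
    TPS lam del m p ≤ lam * ∑ i ∈ Finset.Icc 1 m, p i := by
  have hx : 0 ≤ lam * del := mul_nonneg hlam hdel
  have hterm : ∀ i ∈ Finset.Icc 1 m,
      1 - (lam * del + 1) * p i ≤ (1 - p i) * Real.exp (-(lam * del * p i)) := fun i hi => by
    have hexp := mul_le_mul_of_nonneg_left (Real.one_sub_le_exp_neg (lam * del * p i))
      (sub_nonneg.2 (hp1 i hi))
    nlinarith [mul_nonneg hx (sq_nonneg (p i))]
  have hsum := Finset.sum_le_sum hterm
  rw [Finset.sum_sub_distrib, ← Finset.mul_sum] at hsum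
  simp only [Finset.sum_const, Nat.card_Icc, add_tsub_cancel_right, nsmul_eq_mul,
    mul_one] at hsum
  rw [TPS, div_le_iff₀ (by positivity), mul_assoc]
  exact mul_le_mul_of_nonneg_left (by linarith) hlam

/-- The throughput of the top-`n` strategy. -/
theorem TPS_top (lam del : ℝ) {m n : ℕ} (hmn : n ≤ m) :
    TPS lam del m (fun i => if i ≤ n then (1 : ℝ) else 0) = lam * n / (lam * del + 1) := by
  have hterm : ∀ i : ℕ, (1 - (if i ≤ n then (1 : ℝ) else 0)) *
      Real.exp (-(lam * del * (if i ≤ n then (1 : ℝ) else 0))) =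
        1 - (if i ≤ n then (1 : ℝ) else 0) := fun i => by
    split_ifs <;> simp
  have hfilter : (Finset.Icc 1 m).filter (fun i => i ≤ n) = Finset.Icc 1 n := by
    ext i
    simp only [Finset.mem_filter, Finset.mem_Icc]
    omega
  simp only [TPS, hterm]
  rw [Finset.sum_sub_distrib, Finset.sum_boole, hfilter]
  simp

/-- Throughput efficiency of TIPS (proven form of Theorem 8): the top-`n` strategy
under the TIPS signal delay `τ` satisfies `TPS_τ(p^top) ≥ TPS_Δ(p)/(λτ + 1)` for
every strategy `p ∈ ℙ` and every delay `Δ > 0`. -/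
theorem tips_throughput_efficiency (m n : ℕ) (hn : 1 ≤ n) (hmn : n ≤ m)
    (lam τ Δ : ℝ) (hlam : 0 < lam) (hτ : 0 < τ) (hΔ : 0 < Δ) (p : ℕ → ℝ)
    (hp0 : ∀ i ∈ Finset.Icc 1 m, 0 ≤ p i) (hp1 : ∀ i ∈ Finset.Icc 1 m, p i ≤ 1)
    (hpsum : ∑ i ∈ Finset.Icc 1 m, p i = (n : ℝ)) :
    TPS lam Δ m p / (lam * τ + 1) ≤
      TPS lam τ m (fun i => if i ≤ n then (1 : ℝ) else 0) := by
  rw [TPS_top lam τ hmn, ← hpsum]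
  have hpos : 0 < lam * τ + 1 := by positivity
  exact div_le_div_of_nonneg_right (TPS_le_mul_sum hlam.le hΔ.le hp1) hpos.le
end

section
/- (Expected delay under the delay-of-service attack) Let μ > 0 and T > 0. A real number D satisfies the renewal equation D = ∫_0^T (t + D) μ e^{−μt} dt + ∫_T^∞ T μ e^{−μt} dt if and only if D = (e^{μT} − 1)/μ. -/
/-- The integral of `t + c` against the exponential density with rate `μ` over `[a, b]`. -/
theorem intervalIntegral_add_mul_exponential {μ : ℝ} (hμ : μ ≠ 0) (a b c : ℝ) :
    ∫ t in a..b, (t + c) * (μ * Real.exp (-(μ * t))) =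
      (a + c + 1 / μ) * Real.exp (-(μ * a)) - (b + c + 1 / μ) * Real.exp (-(μ * b)) := by
  have hderiv (t : ℝ) : HasDerivAt (fun t => -((t + c + 1 / μ) * Real.exp (-(μ * t))))
      ((t + c) * (μ * Real.exp (-(μ * t)))) t := by
    have hexp : HasDerivAt (fun t => Real.exp (-(μ * t))) (Real.exp (-(μ * t)) * -(μ * 1)) t :=
      ((hasDerivAt_id t).const_mul μ).neg.exp
    have hlin : HasDerivAt (fun t => t + c + 1 / μ) 1 t :=
      ((hasDerivAt_id t).add_const c).add_const (1 / μ)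
    refine (hlin.mul hexp).neg.congr_deriv ?_
    field_simp
    ring
  rw [intervalIntegral.integral_eq_sub_of_hasDerivAt (fun t _ => hderiv t)
    (Continuous.intervalIntegrable (by fun_prop) _ _)]
  ring

/-- The tail of the exponential distribution with rate `μ`. -/
theorem integral_Ioi_exponential {μ : ℝ} (hμ : 0 < μ) (a : ℝ) :
    ∫ t in Set.Ioi a, μ * Real.exp (-(μ * t)) = Real.exp (-(μ * a)) := by
  simp_rw [← neg_mul, MeasureTheory.integral_const_mul,
    integral_exp_mul_Ioi (neg_lt_zero.mpr hμ) a]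
  field_simp


/-- Expected delay under the delay-of-service attack: `D` solves the renewal equation
`D = ∫_0^T (t+D) μ e^{−μt} dt + ∫_T^∞ T μ e^{−μt} dt` iff `D = (e^{μT} − 1)/μ`. -/
theorem delay_of_service_renewal (μ T D : ℝ) (hμ : 0 < μ) (hT : 0 < T) :
    (D = (∫ t in (0 : ℝ)..T, (t + D) * (μ * Real.exp (-(μ * t)))) +
          ∫ t in Set.Ioi T, T * (μ * Real.exp (-(μ * t))))
      ↔ D = (Real.exp (μ * T) - 1) / μ := by
  rw [intervalIntegral_add_mul_exponential hμ.ne', MeasureTheory.integral_const_mul,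
    integral_Ioi_exponential hμ, mul_zero, neg_zero, Real.exp_zero, Real.exp_neg]
  have hexp : Real.exp (μ * T) ≠ 0 := Real.exp_ne_zero _
  field_simp
  constructor <;> intro h <;> linarith
end
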